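/- arXiv:1110.3001 — 3 statements merged into one kernel-verified Lean document; each statement's English description precedes it below -/
import Mathlib

section
/- (Deterministic suboptimality bound) Let f be a λ-strongly convex function on a real Hilbert space E attaining its minimum at w*, let x_1, …, x_n ∈ E with subgradients g_i of f at x_i and prox-functions p_i(x) = f(x_i) + ⟨g_i, x − x_i⟩ + (λ/2)‖x − x_i‖². Then for every choice of weights α_1, …, α_n ≥ 0 with Σ α_i = 1 and y = Σ α_i x_i, the suboptimality satisfies f(y) − f(w*) ≤ Σ_{i=1}^n α_i f(x_i) − (λ/2) Σ_{i=1}^n α_i ‖x_i − y‖² − max_{i=1,…,n} p_i(w*). -/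
open scoped RealInnerProductSpace

/-- A subgradient of a strongly convex function supports it up to a quadratic term. -/
theorem StrongConvexOn.add_inner_add_sq_le
    {E : Type*} [NormedAddCommGroup E] [InnerProductSpace ℝ E] {m : ℝ} (hm : 0 ≤ m)
    {f : E → ℝ} (hf : StrongConvexOn Set.univ m f) {a v : E}
    (hv : ∀ z : E, f a + ⟪v, z - a⟫ ≤ f z) (z : E) :
    f a + ⟪v, z - a⟫ + m / 2 * ‖z - a‖ ^ 2 ≤ f z := by
  have hc : 0 ≤ m / 2 * ‖z - a‖ ^ 2 := by positivity
  have key : ∀ t : ℝ, 0 < t → t < 1 →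
      f a + ⟪v, z - a⟫ + (1 - t) * (m / 2 * ‖z - a‖ ^ 2) ≤ f z := by
    intro t ht ht1
    have hsub := hv ((1 - t) • a + t • z)
    have hconv := hf.2 (Set.mem_univ a) (Set.mem_univ z) (sub_nonneg.2 ht1.le) ht.le
      (sub_add_cancel 1 t)
    rw [show (1 - t) • a + t • z - a = t • (z - a) by module, real_inner_smul_right] at hsub
    simp only [smul_eq_mul, norm_sub_rev a z] at hconv
    refine le_of_mul_le_mul_left ?_ ht
    linarith
  have hlim : Filter.Tendsto
      (fun t : ℝ => f a + ⟪v, z - a⟫ + (1 - t) * (m / 2 * ‖z - a‖ ^ 2))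
      (nhdsWithin 0 (Set.Ioi 0)) (nhds (f a + ⟪v, z - a⟫ + m / 2 * ‖z - a‖ ^ 2)) := by
    refine Filter.Tendsto.mono_left ?_ nhdsWithin_le_nhds
    refine Continuous.tendsto' (by fun_prop) _ _ (by simp)
  refine le_of_tendsto hlim ?_
  filter_upwards [Ioo_mem_nhdsGT (zero_lt_one' ℝ)] with t ht using key t ht.1 ht.2

/-- The weighted variance around the weighted mean, in terms of second moments. -/
theorem sum_mul_norm_sub_weighted_sum_sq
    {E ι : Type*} [NormedAddCommGroup E] [InnerProductSpace ℝ E] (s : Finset ι)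
    (w : ι → ℝ) (x : ι → E) (hw : ∑ i ∈ s, w i = 1) :
    ∑ i ∈ s, w i * ‖x i - ∑ j ∈ s, w j • x j‖ ^ 2 =
      ∑ i ∈ s, w i * ‖x i‖ ^ 2 - ‖∑ j ∈ s, w j • x j‖ ^ 2 := by
  set y := ∑ j ∈ s, w j • x j with hy
  have hinner : ∑ i ∈ s, w i * ⟪x i, y⟫ = ‖y‖ ^ 2 := by
    rw [← real_inner_self_eq_norm_sq]
    nth_rewrite 2 [hy]
    simp only [sum_inner, real_inner_smul_left]
  have hexpand : ∀ i ∈ s, w i * ‖x i - y‖ ^ 2 =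
      w i * ‖x i‖ ^ 2 - 2 * (w i * ⟪x i, y⟫) + w i * ‖y‖ ^ 2 := by
    intro i _
    rw [norm_sub_sq_real]
    ring
  rw [Finset.sum_congr rfl hexpand, Finset.sum_add_distrib, Finset.sum_sub_distrib,
    ← Finset.mul_sum, ← Finset.sum_mul, hinner, hw]
  ring

/-- Jensen's inequality for strongly convex functions, with the variance as the gain. -/
theorem StrongConvexOn.map_sum_add_variance_le
    {E ι : Type*} [NormedAddCommGroup E] [InnerProductSpace ℝ E] {C : Set E} {m : ℝ}
    {f : E → ℝ} (hf : StrongConvexOn C m f) {s : Finset ι} {w : ι → ℝ} {x : ι → E}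
    (hw0 : ∀ i ∈ s, 0 ≤ w i) (hw : ∑ i ∈ s, w i = 1) (hx : ∀ i ∈ s, x i ∈ C) :
    f (∑ i ∈ s, w i • x i) + m / 2 * ∑ i ∈ s, w i * ‖x i - ∑ j ∈ s, w j • x j‖ ^ 2 ≤
      ∑ i ∈ s, w i * f (x i) := by
  have hjensen := (strongConvexOn_iff_convex.1 hf).map_sum_le hw0 hw hx
  have hsplit : ∑ i ∈ s, w i • (f (x i) - m / 2 * ‖x i‖ ^ 2) =
      ∑ i ∈ s, w i * f (x i) - m / 2 * ∑ i ∈ s, w i * ‖x i‖ ^ 2 := by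
    rw [Finset.mul_sum, ← Finset.sum_sub_distrib]
    refine Finset.sum_congr rfl fun i _ => ?_
    rw [smul_eq_mul]
    ring
  rw [sum_mul_norm_sub_weighted_sum_sq s w x hw]
  linarith

/-- **Deterministic suboptimality bound.** For a `lam`-strongly convex `f`
attaining its minimum at `wstar`, points `x i` with subgradients `g i` and prox-functions
`p i`, simplex weights `α`, and `y = ∑ α i • x i`, the suboptimality satisfies
`f y - f wstar ≤ ∑ α i * f (x i) - lam/2 * ∑ α i * ‖x i - y‖² - max_i p i wstar`. -/
theorem deterministic_suboptimality_bound
    {E : Type*} [NormedAddCommGroup E] [InnerProductSpace ℝ E] [CompleteSpace E]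
    (lam : ℝ) (hlam : 0 < lam) (f : E → ℝ)
    (hf : StrongConvexOn Set.univ lam f)
    (wstar : E) (hw : ∀ z : E, f wstar ≤ f z)
    (n : ℕ) (x g : Fin (n + 1) → E)
    (hg : ∀ i, ∀ z : E, f (x i) + ⟪g i, z - x i⟫ ≤ f z)
    (p : Fin (n + 1) → E → ℝ)
    (hp : ∀ i, ∀ z : E,
      p i z = f (x i) + ⟪g i, z - x i⟫ + lam / 2 * ‖z - x i‖ ^ 2)
    (α : Fin (n + 1) → ℝ) (hα : ∀ i, 0 ≤ α i) (hsum : ∑ i, α i = 1)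
    (y : E) (hy : y = ∑ i, α i • x i) :
    f y - f wstar ≤ ∑ i, α i * f (x i) - lam / 2 * ∑ i, α i * ‖x i - y‖ ^ 2 -
      Finset.univ.sup' ⟨0, Finset.mem_univ 0⟩ (fun i => p i wstar) := by
  have hmax : Finset.univ.sup' ⟨0, Finset.mem_univ 0⟩ (fun i => p i wstar) ≤ f wstar := by
    refine Finset.sup'_le _ _ fun i _ => ?_
    rw [hp]
    exact hf.add_inner_add_sq_le hlam.le (hg i) wstar
  have hjensen := hf.map_sum_add_variance_le (x := x) (fun i _ => hα i) hsum
    (fun i _ => Set.mem_univ (x i))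
  rw [← hy] at hjensen
  linarith
end

section
/- (Key one-step inequality behind Theorem 1) Let E be a real Hilbert space, λ > 0, and let P : E → ℝ be λ-strongly convex and attain its minimum at x*. Let q(x) = c + ⟨g, x − x*⟩ + (λ/2)‖x − x*‖² with c ∈ ℝ and g ∈ E, ‖g‖ ≤ G. Then for every α ∈ [0,1], inf_x [(1 − α)P(x) + α q(x)] ≥ (1 − α)P(x*) + α c − α² G²/(2λ). -/
open scoped RealInnerProductSpace

/-- Quadratic growth of a strongly convex function around a global minimizer. -/
theorem StrongConvexOn.add_sq_norm_sub_le_of_forall_le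
    {E : Type*} [NormedAddCommGroup E] [NormedSpace ℝ E] {m : ℝ} {f : E → ℝ}
    (hf : StrongConvexOn Set.univ m f) {x : E} (hx : ∀ z, f x ≤ f z) (z : E) :
    f x + m / 2 * ‖z - x‖ ^ 2 ≤ f z := by
  set K := m / 2 * ‖z - x‖ ^ 2 with hK
  have scaled_growth (a : ℝ) (ha0 : 0 ≤ a) (ha1 : a < 1) : a * K ≤ f z - f x := by
    have h := hf.2 (Set.mem_univ x) (Set.mem_univ z) ha0 (sub_nonneg.2 ha1.le)
      (add_sub_cancel a 1)
    have hmin := hx (a • x + (1 - a) • z)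
    simp only [smul_eq_mul] at h
    rw [norm_sub_rev x z, ← hK] at h
    refine le_of_mul_le_mul_left ?_ (sub_pos.2 ha1)
    linarith
  by_contra! hlt
  have hD : 0 ≤ f z - f x := sub_nonneg.2 (hx z)
  have hKpos : 0 < K := by linarith
  have h := scaled_growth ((f z - f x + K) / (2 * K)) (by positivity)
    (by rw [div_lt_one (by positivity)]; linarith)
  have hmul : (f z - f x + K) / (2 * K) * K = (f z - f x + K) / 2 := by field_simp
  linarith

/-- **Key one-step inequality behind Theorem 1.** Let `P : E → ℝ` be
`lam`-strongly convex on a real Hilbert space, attaining its minimum at `xstar`. Let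
`q x = c + ⟪g, x - xstar⟫ + (lam/2)‖x - xstar‖²` with `‖g‖ ≤ G`. Then for every
`α ∈ [0,1]`,
`inf_x [(1-α) P x + α q x] ≥ (1-α) P xstar + α c - α² G² / (2 lam)`. -/
theorem one_step_key_inequality
    {E : Type*} [NormedAddCommGroup E] [InnerProductSpace ℝ E] [CompleteSpace E]
    (lam G : ℝ) (hlam : 0 < lam)
    (P : E → ℝ) (hP : StrongConvexOn Set.univ lam P)
    (xstar : E) (hxstar : ∀ z : E, P xstar ≤ P z)
    (c : ℝ) (g : E) (hg : ‖g‖ ≤ G)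
    (α : ℝ) (hα0 : 0 ≤ α) (hα1 : α ≤ 1) :
    (1 - α) * P xstar + α * c - α ^ 2 * G ^ 2 / (2 * lam) ≤
      ⨅ z : E, ((1 - α) * P z +
        α * (c + ⟪g, z - xstar⟫ + lam / 2 * ‖z - xstar‖ ^ 2)) := by
  refine le_ciInf fun z => ?_
  have hgrowth := mul_le_mul_of_nonneg_left
    (hP.add_sq_norm_sub_le_of_forall_le hxstar z) (sub_nonneg.2 hα1)
  have hinner : -(G * ‖z - xstar‖) ≤ ⟪g, z - xstar⟫ :=
    (neg_le_neg (mul_le_mul_of_nonneg_right hg (norm_nonneg _))).trans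
      (neg_le_of_abs_le (abs_real_inner_le_norm g (z - xstar)))
  have hlinear := mul_le_mul_of_nonneg_left hinner hα0
  have hsq : 0 ≤ (lam * ‖z - xstar‖ - α * G) ^ 2 / (2 * lam) := by positivity
  have hexpand : (lam * ‖z - xstar‖ - α * G) ^ 2 / (2 * lam) =
      lam / 2 * ‖z - xstar‖ ^ 2 - α * G * ‖z - xstar‖ + α ^ 2 * G ^ 2 / (2 * lam) := by
    field_simp
    ring
  linarith
end

section
/- (Theorem 1, one-step recursion) Let E be a real Hilbert space, λ > 0, G > 0. Let q_1, …, q_n be prox-quadratics q_i(x) = c_i + ⟨g_i, x − x_i⟩ + (λ/2)‖x − x_i‖² with ‖g_i‖ ≤ G, let β_1, …, β_n ≥ 0 with Σ β_i = 1, set P_n = Σ_{i=1}^n β_i q_i, and define Û_n = Σ_{i=1}^n β_i c_i − min P_n. Let x_{n+1} = argmin P_n, let q_{n+1}(x) = c_{n+1} + ⟨g_{n+1}, x − x_{n+1}⟩ + (λ/2)‖x − x_{n+1}‖² with ‖g_{n+1}‖ ≤ G, and set α = λ Û_n / G² (assume 0 ≤ α ≤ 1). Define the updated weights β'_i = (1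 − α) β_i for i ≤ n and β'_{n+1} = α, and let P_{n+1} = Σ_{i=1}^{n+1} β'_i q_i and Û_{n+1} = Σ_{i=1}^{n+1} β'_i c_i − min P_{n+1}. Then Û_{n+1} ≤ Û_n − (λ/(2G²)) Û_n². -/
open scoped RealInnerProductSpace

section

lemma nonneg_of_forall_pos_mul_add_sq_mul_nonneg {a k : ℝ} (hk : 0 ≤ k)
    (h : ∀ t : ℝ, 0 < t → 0 ≤ t * a + t ^ 2 * k) : 0 ≤ a := by
  by_contra! ha
  have ht : 0 < -a / (k + 1) := div_pos (by linarith) (by linarith)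
  have hk' : -a / (k + 1) * (k + 1) = -a := div_mul_cancel₀ _ (by linarith)
  have := h _ ht
  nlinarith [mul_pos ht ht]

variable {E : Type*} [NormedAddCommGroup E] [InnerProductSpace ℝ E]

lemma proxQuadratic_add_smul (lam c : ℝ) (g p x d : E) (t : ℝ) :
    c + ⟪g, x + t • d - p⟫ + lam / 2 * ‖x + t • d - p‖ ^ 2 =
      (c + ⟪g, x - p⟫ + lam / 2 * ‖x - p‖ ^ 2) + t * (⟪g, d⟫ + lam * ⟪x - p, d⟫)
        + t ^ 2 * (lam / 2 * ‖d‖ ^ 2) := by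
  rw [show x + t • d - p = (x - p) + t • d by abel, norm_add_sq_real, norm_smul, mul_pow,
    Real.norm_eq_abs, sq_abs, inner_add_right, inner_smul_right, inner_smul_right]
  ring

/-- Quadratic growth at the minimizer of a convex combination of prox-quadratics. -/
lemma sum_proxQuadratic_quadratic_growth {ι : Type*} [Fintype ι] {lam : ℝ} (hlam : 0 ≤ lam)
    (c β : ι → ℝ) (g p : ι → E) (hβ : ∑ i, β i = 1) {P : E → ℝ}
    (hP : P = fun z => ∑ i, β i * (c i + ⟪g i, z - p i⟫ + lam / 2 * ‖z - p i‖ ^ 2))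
    {x : E} (hx : ∀ z, P x ≤ P z) (z : E) :
    P x + lam / 2 * ‖z - x‖ ^ 2 ≤ P z := by
  set A := ∑ i, β i * (⟪g i, z - x⟫ + lam * ⟪x - p i, z - x⟫) with hA
  have expand (t : ℝ) :
      P (x + t • (z - x)) = P x + t * A + t ^ 2 * (lam / 2 * ‖z - x‖ ^ 2) := by
    rw [← one_mul (t ^ 2 * _), ← hβ, Finset.sum_mul, hA, Finset.mul_sum]
    simp only [hP, proxQuadratic_add_smul, ← Finset.sum_add_distrib]
    exact Finset.sum_congr rfl fun i _ => by ring
  have hA0 : 0 ≤ A := nonneg_of_forall_pos_mul_add_sq_mul_nonneg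
    (k := lam / 2 * ‖z - x‖ ^ 2) (by positivity) fun t _ => by
      linarith [hx (x + t • (z - x)), expand t]
  have h1 := expand 1
  rw [one_smul, add_sub_cancel] at h1
  linarith

/-- Lower bound by completing the square and Cauchy–Schwarz. -/
lemma neg_sq_div_le_inner_add_sq {lam G α : ℝ} (hlam : 0 < lam) (hα : 0 ≤ α) {g : E}
    (hg : ‖g‖ ≤ G) (d : E) :
    -(α ^ 2 * G ^ 2 / (2 * lam)) ≤ α * ⟪g, d⟫ + lam / 2 * ‖d‖ ^ 2 := by
  have h1 : -(G * ‖d‖) ≤ ⟪g, d⟫ := by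
    have := neg_le_of_abs_le (abs_real_inner_le_norm g d)
    have := mul_le_mul_of_nonneg_right hg (norm_nonneg d)
    linarith
  have h2 : 0 ≤ (α * G - lam * ‖d‖) ^ 2 / (2 * lam) := by positivity
  have h3 : (α * G - lam * ‖d‖) ^ 2 / (2 * lam) =
      α ^ 2 * G ^ 2 / (2 * lam) - α * (G * ‖d‖) + lam / 2 * ‖d‖ ^ 2 := by
    field_simp
    ring
  linarith [mul_le_mul_of_nonneg_left h1 hα]

end

/-- **Theorem 1, one-step recursion.** Given prox-quadratics
`q i z = c i + ⟪g i, z - xp i⟫ + (lam/2)‖z - xp i‖²` with `‖g i‖ ≤ G`, simplex weights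
`β`, the aggregated model `Pn = ∑ β i * q i` with minimizer `xn1` and gap
`Un = ∑ β i * c i - min Pn`, a new prox-quadratic `q_{n+1}` anchored at `xn1` with
`‖gn1‖ ≤ G`, and the step size `α = lam * Un / G²` (assumed in `[0,1]`), the updated gap
`Un1 = ((1-α) ∑ β i * c i + α * cn1) - min P_{n+1}` satisfies
`Un1 ≤ Un - (lam/(2 G²)) Un²`.  (Here `P_{n+1} = (1-α) Pn + α q_{n+1}` is exactly the
model obtained from the updated weights `β'_i = (1-α) β_i`, `β'_{n+1} = α`.) -/
theorem one_step_recursion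
    {E : Type*} [NormedAddCommGroup E] [InnerProductSpace ℝ E] [CompleteSpace E]
    (n : ℕ) (lam G : ℝ) (hlam : 0 < lam) (hG : 0 < G)
    (c : Fin n → ℝ) (g : Fin n → E) (xp : Fin n → E)
    (hg : ∀ i, ‖g i‖ ≤ G)
    (β : Fin n → ℝ) (hβ : ∀ i, 0 ≤ β i) (hβ1 : ∑ i, β i = 1)
    (Pn : E → ℝ)
    (hPn : Pn = fun z => ∑ i, β i * (c i + ⟪g i, z - xp i⟫ + lam / 2 * ‖z - xp i‖ ^ 2))
    (xn1 : E) (hxn1 : ∀ z : E, Pn xn1 ≤ Pn z)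
    (Un : ℝ) (hUn : Un = (∑ i, β i * c i) - Pn xn1)
    (cn1 : ℝ) (gn1 : E) (hgn1 : ‖gn1‖ ≤ G)
    (α : ℝ) (hα : α = lam * Un / G ^ 2) (hα0 : 0 ≤ α) (hα1 : α ≤ 1)
    (Un1 : ℝ)
    (hUn1 : Un1 = ((1 - α) * ∑ i, β i * c i + α * cn1) -
      ⨅ z : E, ((1 - α) * Pn z +
        α * (cn1 + ⟪gn1, z - xn1⟫ + lam / 2 * ‖z - xn1‖ ^ 2))) :
    Un1 ≤ Un - lam / (2 * G ^ 2) * Un ^ 2 := by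
  have lower : (1 - α) * Pn xn1 + α * cn1 - α ^ 2 * G ^ 2 / (2 * lam) ≤
      ⨅ z : E, ((1 - α) * Pn z +
        α * (cn1 + ⟪gn1, z - xn1⟫ + lam / 2 * ‖z - xn1‖ ^ 2)) := by
    refine le_ciInf fun z => ?_
    have growth := mul_le_mul_of_nonneg_left
      (sum_proxQuadratic_quadratic_growth hlam.le c β g xp hβ1 hPn hxn1 z) (sub_nonneg.2 hα1)
    linarith [neg_sq_div_le_inner_add_sq hlam hα0 hgn1 (z - xn1)]
  have gap : Un1 ≤ (1 - α) * Un + α ^ 2 * G ^ 2 / (2 * lam) := by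
    rw [hUn1, hUn]
    linarith
  have step : (1 - α) * Un + α ^ 2 * G ^ 2 / (2 * lam) = Un - lam / (2 * G ^ 2) * Un ^ 2 := by
    rw [hα]
    field_simp
    ring
  exact gap.trans_eq step
end
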